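/- Let L and H be restricted Lie algebras over a field F of characteristic p > 0 such that u(L) ≅ u(H) as F-algebras. If L is finite-dimensional and p-nilpotent, then the nilpotence classes of L and H differ by at most one: |cl(L) − cl(H)| ≤ 1. -/

import Mathlib

open UniversalEnvelopingAlgebra

attribute [local instance 100] LieRing.ofAssociativeRing

/-- A restricted Lie algebra over a field `F` of characteristic `p`: a Lie algebra equipped
with a `p`-map `x ↦ x^[p]` satisfying Jacobson's identities.  The additive identity
`(x+y)^[p] = x^[p] + y^[p] + Σ sᵢ(x,y)` (with `sᵢ` the Jacobson polynomials) is expressed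
faithfully inside the universal enveloping algebra, where it reads
`ι((x+y)^[p]) - ι(x^[p]) - ι(y^[p]) = (ι x + ι y)^p - (ι x)^p - (ι y)^p`. -/
class RestrictedLieAlgebra (p : ℕ) (F : Type*) (L : Type*) [Field F]
    [LieRing L] [LieAlgebra F L] : Type _ where
  pOp : L → L
  pOp_smul : ∀ (a : F) (x : L), pOp (a • x) = a ^ p • pOp x
  ad_pOp : ∀ x y : L, ⁅pOp x, y⁆ = ((LieAlgebra.ad F L x) ^ p) y
  pOp_add : ∀ x y : L,
    ι F (pOp (x + y)) - ι F (pOp x) - ι F (pOp y)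
      = (ι F x + ι F y) ^ p - (ι F x) ^ p - (ι F y) ^ p

namespace RestrictedLieAlgebra

variable (p : ℕ) (F : Type*) [Field F]

section Defs

variable (L : Type*) [LieRing L] [LieAlgebra F L] [RestrictedLieAlgebra p F L]

/-- The `p`-map of a restricted Lie algebra. -/
abbrev pmap (x : L) : L := RestrictedLieAlgebra.pOp (p := p) (F := F) x

/-- The relation defining the restricted enveloping algebra as a quotient of the
universal enveloping algebra: `x^p = x^[p]` for all `x ∈ L`. -/
def uRel : UniversalEnvelopingAlgebra F L → UniversalEnvelopingAlgebra F L → Prop :=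
  fun a b => ∃ x : L, a = (ι F x) ^ p ∧ b = ι F (pmap p F L x)

/-- The restricted enveloping algebra `u(L)`: the quotient of the universal enveloping
algebra of `L` by the two-sided ideal generated by `{x^p - x^[p] : x ∈ L}`. -/
abbrev uEnv := RingQuot (uRel p F L)

/-- The canonical (linear) embedding `L → u(L)`. -/
def uemb : L →ₗ[F] uEnv p F L :=
  ((RingQuot.mkAlgHom F (uRel p F L)).toLinearMap).comp (ι F : L →ₗ⁅F⁆ _).toLinearMap

variable [Fact p.Prime]

/-- The augmentation map `ε : u(L) → F`, induced by `x ↦ 0` for `x ∈ L`. -/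
noncomputable def aug : uEnv p F L →ₐ[F] F :=
  RingQuot.liftAlgHom F
    ⟨(UniversalEnvelopingAlgebra.lift F) (0 : L →ₗ⁅F⁆ F), by
      rintro a b ⟨x, rfl, rfl⟩
      simp [UniversalEnvelopingAlgebra.lift_ι_apply,
        zero_pow (Nat.Prime.ne_zero (Fact.out : p.Prime))]⟩

/-- The augmentation ideal `ω(L)`, i.e. the kernel of the augmentation map, as a
subspace of `u(L)`. -/
noncomputable def omegaIdeal : Submodule F (uEnv p F L) :=
  LinearMap.ker (aug p F L).toLinearMap

/-- The image of `L` inside `u(L)`. -/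
def lSub : Submodule F (uEnv p F L) := LinearMap.range (uemb p F L)

end Defs

section Closure

variable {L : Type*} [LieRing L] [LieAlgebra F L] [RestrictedLieAlgebra p F L]

/-- The restricted subalgebra generated by a subset `S` of `L`: the smallest Lie
subalgebra containing `S` which is closed under the `p`-map. -/
def restrictedClosure (S : Set L) : LieSubalgebra F L :=
  sInf {K : LieSubalgebra F L | S ⊆ K ∧ ∀ x ∈ K, pmap p F L x ∈ K}

/-- For a subalgebra `N ⊆ L`, the restricted subalgebra `N^p` generated by all
`x^[p]`, `x ∈ N`. -/
def subPPow (K : LieSubalgebra F L) : LieSubalgebra F L :=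
  restrictedClosure p F (pmap p F L '' K)

end Closure

section PNilpotent

variable (L : Type*) [LieRing L] [LieAlgebra F L] [RestrictedLieAlgebra p F L]

/-- `L` is `p`-nilpotent if `L^{pˢ} = 0` for some `s`, where `L^p` denotes the restricted
subalgebra generated by all `x^[p]`. -/
def IsPNilpotent : Prop :=
  ∃ s : ℕ, (subPPow p F)^[s] (⊤ : LieSubalgebra F L) = ⊥

/-- The derived subalgebra `L' = γ₂(L)` as a submodule of `L`. -/
abbrev derivedSub : Submodule F L := (LieModule.lowerCentralSeries F L L 1).toSubmodule

/-- `L'_p`, the restricted subalgebra generated by `L'`, as a submodule. -/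
def derivedP : Submodule F L :=
  (restrictedClosure p F (derivedSub F L : Set L)).toSubmodule

/-- `L'^p + γ₃(L)`, as a submodule of `L`. -/
def mainIdeal : Submodule F L :=
  (subPPow p F (restrictedClosure p F (derivedSub F L : Set L))).toSubmodule
    ⊔ (LieModule.lowerCentralSeries F L L 2).toSubmodule

end PNilpotent

end RestrictedLieAlgebra

/-- The nilpotence class of a Lie algebra `L`: the least `c` with `γ_{c+1}(L) = 0`
(with the convention `γ₁(L) = L`, so `γ_{c+1}(L)` is `LieModule.lowerCentralSeries F L L c`). -/
noncomputable def nilClass (F L : Type*) [Field F] [LieRing L] [LieAlgebra F L] : ℕ :=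
  sInf {c : ℕ | LieModule.lowerCentralSeries F L L c = ⊥}

namespace RestrictedLieAlgebra

section Finiteness

variable {F A ι : Type*} [Field F] [Ring A] [Algebra F A] {e : ι → A}

lemma prod_map_mem_span_pow (l : List ι) :
    (l.map e).prod ∈ Submodule.span F (Set.range e) ^ l.length := by
  induction l with
  | nil => simpa using (Submodule.one_le (R := F) (A := A)).mp le_rfl
  | cons i l ih =>
    rw [List.map_cons, List.prod_cons, List.length_cons, pow_succ']
    exact Submodule.mul_mem_mul (Submodule.subset_span ⟨i, rfl⟩) ih

/-- Products of generators whose commutators lie in the span `V` of the generators are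
independent of the order of the factors, up to shorter products. -/
lemma prod_map_sub_mem_of_perm
    (hc : ∀ i j, e i * e j - e j * e i ∈ Submodule.span F (Set.range e))
    {l l' : List ι} (h : l.Perm l') :
    (l.map e).prod - (l'.map e).prod ∈ Submodule.span F (Set.range e) ^ (l.length - 1) := by
  induction h with
  | nil => simp
  | @cons i l l' h ih =>
    rw [List.map_cons, List.prod_cons, List.map_cons, List.prod_cons, ← mul_sub]
    rcases l with _ | ⟨j, l⟩
    · rw [List.nil_perm.mp h]
      simp
    · rw [List.length_cons, List.length_cons, Nat.add_sub_cancel, pow_succ']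
      exact Submodule.mul_mem_mul (Submodule.subset_span ⟨i, rfl⟩) ih
  | swap i j l =>
    have : ((j :: i :: l).map e).prod - ((i :: j :: l).map e).prod
        = (e j * e i - e i * e j) * (l.map e).prod := by
      simp only [List.map_cons, List.prod_cons]
      noncomm_ring
    rw [this, List.length_cons, List.length_cons, Nat.add_sub_cancel, pow_succ']
    exact Submodule.mul_mem_mul (hc j i) (prod_map_mem_span_pow l)
  | trans h₁ h₂ ih₁ ih₂ =>
    rw [← h₁.length_eq] at ih₂
    simpa using add_mem ih₁ ih₂

lemma span_pow_eq_span_prod_map (n : ℕ) :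
    Submodule.span F (Set.range e) ^ n
      = Submodule.span F {a | ∃ l : List ι, l.length = n ∧ (l.map e).prod = a} := by
  induction n with
  | zero => simp [Submodule.one_eq_span, List.length_eq_zero_iff, eq_comm]
  | succ n ih =>
    rw [pow_succ', ih, Submodule.span_mul_span]
    congr 1
    ext a
    constructor
    · rintro ⟨_, ⟨i, rfl⟩, _, ⟨l, rfl, rfl⟩, rfl⟩
      exact ⟨i :: l, by simp, by simp⟩
    · rintro ⟨_ | ⟨i, l⟩, hl, rfl⟩
      · simp at hl
      · exact ⟨e i, ⟨i, rfl⟩, (l.map e).prod, ⟨l, by simpa using hl, rfl⟩, by simp⟩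

/-- The spanning half of the Poincaré–Birkhoff–Witt theorem in the restricted case, in the form of
a finiteness statement. -/
lemma finite_of_commutator_mem_of_pow_mem [Finite ι] {p : ℕ} (hp : 2 ≤ p)
    (h1 : 1 ∈ Submodule.span F (Set.range e))
    (hc : ∀ i j, e i * e j - e j * e i ∈ Submodule.span F (Set.range e))
    (hpow : ∀ i, e i ^ p ∈ Submodule.span F (Set.range e))
    (hgen : Algebra.adjoin F (Set.range e) = ⊤) : Module.Finite F A := by
  classical
  have := Fintype.ofFinite ι
  set V := Submodule.span F (Set.range e) with hV
  have h1V : (1 : Submodule F A) ≤ V := Submodule.one_le.mpr h1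
  set N := Fintype.card ι * (p - 1)
  have step : ∀ n, N ≤ n → V ^ (n + 1) ≤ V ^ n := by
    intro n hn
    rw [hV, span_pow_eq_span_prod_map (n + 1), Submodule.span_le]
    rintro _ ⟨l, hl, rfl⟩
    obtain ⟨i, hi⟩ : ∃ i, p ≤ l.count i := by
      by_contra! h
      have : l.length ≤ N := by
        rw [← List.sum_toFinset_count_eq_length]
        calc ∑ i ∈ l.toFinset, l.count i ≤ ∑ _i ∈ l.toFinset, (p - 1) :=
              Finset.sum_le_sum fun i _ => by have := h i; omega
          _ = l.toFinset.card * (p - 1) := by simp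
          _ ≤ N := Nat.mul_le_mul_right _ (Finset.card_le_univ _)
      omega
    obtain ⟨l', hl'⟩ := ((List.replicate_sublist_iff (l := l)).mpr hi).exists_perm_append
    have hlen : l.length = p + l'.length := by simp [hl'.length_eq]
    have hd := prod_map_sub_mem_of_perm (F := F) hc hl'
    have hm : ((List.replicate p i ++ l').map e).prod ∈ V ^ n := by
      rw [List.map_append, List.prod_append, List.map_replicate, List.prod_replicate]
      have : V ^ (l'.length + 1) ≤ V ^ n := pow_le_pow_right' h1V (by omega)
      rw [pow_succ'] at this
      exact this (Submodule.mul_mem_mul (hpow i) (prod_map_mem_span_pow l'))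
    rw [hl, Nat.add_sub_cancel] at hd
    simpa using add_mem hd hm
  have stab : ∀ n, V ^ n ≤ V ^ N := by
    intro n
    rcases le_total n N with h | h
    · exact pow_le_pow_right' h1V h
    · induction n, h using Nat.le_induction with
      | base => exact le_rfl
      | succ n hn ih => exact (step n hn).trans ih
  have htop : V ^ N = ⊤ := by
    rw [eq_top_iff]
    intro a _
    have ha : a ∈ Algebra.adjoin F (Set.range e) := hgen ▸ Algebra.mem_top
    induction ha using Algebra.adjoin_induction with
    | mem x hx => exact stab 1 (by simpa using Submodule.subset_span hx)
    | algebraMap r =>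
      exact stab 0 (by rw [pow_zero]; exact Submodule.algebraMap_mem r)
    | add x y _ _ hx hy => exact add_mem (hx trivial) (hy trivial)
    | mul x y _ _ hx hy =>
      exact stab (N + N) (pow_add V N N ▸ Submodule.mul_mem_mul (hx trivial) (hy trivial))
  exact ⟨htop ▸ Submodule.FG.pow (Submodule.fg_span (Set.finite_range e)) N⟩

end Finiteness

section LiePowers

variable (F A : Type*) [Field F] [Ring A] [Algebra F A]

/-- The upper Lie powers of an associative algebra: `A` itself, and then successively the
two-sided ideal generated by the commutators of the previous term with `A`. -/
def upperLiePower : ℕ → Submodule F A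
  | 0 => ⊤
  | n + 1 => ⊤ * Submodule.span F {c | ∃ a ∈ upperLiePower n, ∃ b, a * b - b * a = c} * ⊤

/-- The span of the products of two upper Lie powers of positive degrees with sum `n`. -/
def upperLieProduct (n : ℕ) : Submodule F A :=
  Submodule.span F {c | ∃ i j, 1 ≤ i ∧ 1 ≤ j ∧ i + j = n ∧
    ∃ a ∈ upperLiePower F A i, ∃ b ∈ upperLiePower F A j, a * b = c}

variable {F A}

/-- A subspace is stable under multiplication by the whole algebra on both sides. -/
def IsTwoSided (S : Submodule F A) : Prop :=
  ∀ a, ∀ s ∈ S, a * s ∈ S ∧ s * a ∈ S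

lemma isTwoSided_top_mul_mul_top (S : Submodule F A) : IsTwoSided (⊤ * S * ⊤) := by
  intro a s hs
  constructor
  · have h : (⊤ : Submodule F A) * (⊤ * S * ⊤) ≤ ⊤ * S * ⊤ := by
      rw [← mul_assoc, ← mul_assoc]
      exact mul_le_mul_left (mul_le_mul_left le_top _) _
    exact h (Submodule.mul_mem_mul Submodule.mem_top hs)
  · have h : (⊤ * S * ⊤) * (⊤ : Submodule F A) ≤ ⊤ * S * ⊤ := by
      rw [mul_assoc]
      exact mul_le_mul_right le_top _
    exact h (Submodule.mul_mem_mul hs Submodule.mem_top)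

lemma le_top_mul_mul_top (S : Submodule F A) : S ≤ ⊤ * S * ⊤ := by
  intro s hs
  simpa using Submodule.mul_mem_mul
    (Submodule.mul_mem_mul (Submodule.mem_top : (1 : A) ∈ (⊤ : Submodule F A)) hs)
    (Submodule.mem_top : (1 : A) ∈ (⊤ : Submodule F A))

lemma top_mul_mul_top_le_of_forall {S T : Submodule F A}
    (h : ∀ s ∈ S, ∀ a b, a * s * b ∈ T) : ⊤ * S * ⊤ ≤ T := by
  rw [Submodule.mul_le]
  intro x hx b _
  have : ⊤ * S ≤ T.comap (LinearMap.mulRight F b) :=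
    Submodule.mul_le.mpr fun a _ s hs => h s hs a b
  exact this hx

lemma top_mul_mul_top_le {S T : Submodule F A} (hT : IsTwoSided T) (h : S ≤ T) :
    ⊤ * S * ⊤ ≤ T :=
  top_mul_mul_top_le_of_forall fun s hs a b => (hT b _ (hT a s (h hs)).1).2

lemma IsTwoSided.sup {S T : Submodule F A} (hS : IsTwoSided S) (hT : IsTwoSided T) :
    IsTwoSided (S ⊔ T) := by
  intro a x hx
  obtain ⟨s, hs, t, ht, rfl⟩ := Submodule.mem_sup.mp hx
  rw [mul_add, add_mul]
  exact ⟨add_mem (Submodule.mem_sup_left (hS a s hs).1) (Submodule.mem_sup_right (hT a t ht).1),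
    add_mem (Submodule.mem_sup_left (hS a s hs).2) (Submodule.mem_sup_right (hT a t ht).2)⟩

lemma isTwoSided_upperLiePower (n : ℕ) : IsTwoSided (upperLiePower F A n) := by
  cases n with
  | zero => exact fun _ _ _ => ⟨trivial, trivial⟩
  | succ n => exact isTwoSided_top_mul_mul_top _

lemma commutator_mem_upperLiePower {n : ℕ} {a : A} (ha : a ∈ upperLiePower F A n) (b : A) :
    a * b - b * a ∈ upperLiePower F A (n + 1) :=
  le_top_mul_mul_top _ (Submodule.subset_span ⟨a, ha, b, rfl⟩)

lemma upperLiePower_succ_le {n : ℕ} {T : Submodule F A} (hT : IsTwoSided T)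
    (h : ∀ a ∈ upperLiePower F A n, ∀ b, a * b - b * a ∈ T) : upperLiePower F A (n + 1) ≤ T := by
  refine top_mul_mul_top_le hT (Submodule.span_le.mpr ?_)
  rintro _ ⟨a, ha, b, rfl⟩
  exact h a ha b

lemma mul_mem_upperLieProduct {i j n : ℕ} (hi : 1 ≤ i) (hj : 1 ≤ j) (hn : i + j = n) {a b : A}
    (ha : a ∈ upperLiePower F A i) (hb : b ∈ upperLiePower F A j) :
    a * b ∈ upperLieProduct F A n :=
  Submodule.subset_span ⟨i, j, hi, hj, hn, a, ha, b, hb, rfl⟩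

lemma isTwoSided_upperLieProduct (n : ℕ) : IsTwoSided (upperLieProduct F A n) := by
  intro c x hx
  induction hx using Submodule.span_induction with
  | mem x hx =>
    obtain ⟨i, j, hi, hj, hn, a, ha, b, hb, rfl⟩ := hx
    rw [← mul_assoc, mul_assoc a b c]
    exact ⟨mul_mem_upperLieProduct hi hj hn (isTwoSided_upperLiePower i c a ha).1 hb,
      mul_mem_upperLieProduct hi hj hn ha (isTwoSided_upperLiePower j c b hb).2⟩
  | zero => simp
  | add x y _ _ hx hy =>
    rw [mul_add, add_mul]
    exact ⟨add_mem hx.1 hy.1, add_mem hx.2 hy.2⟩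
  | smul r x _ hx =>
    rw [mul_smul_comm, smul_mul_assoc]
    exact ⟨Submodule.smul_mem _ r hx.1, Submodule.smul_mem _ r hx.2⟩

lemma commutator_mem_upperLieProduct {n : ℕ} {x : A} (hx : x ∈ upperLieProduct F A n) (c : A) :
    x * c - c * x ∈ upperLieProduct F A (n + 1) := by
  induction hx using Submodule.span_induction with
  | mem x hx =>
    obtain ⟨i, j, hi, hj, hn, a, ha, b, hb, rfl⟩ := hx
    have : a * b * c - c * (a * b) = a * (b * c - c * b) + (a * c - c * a) * b := by
      noncomm_ring
    rw [this]
    exact add_mem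
      (mul_mem_upperLieProduct hi (by omega) (by omega) ha (commutator_mem_upperLiePower hb c))
      (mul_mem_upperLieProduct (by omega) hj (by omega) (commutator_mem_upperLiePower ha c) hb)
  | zero => simp
  | add x y _ _ hx hy =>
    have : (x + y) * c - c * (x + y) = (x * c - c * x) + (y * c - c * y) := by noncomm_ring
    rw [this]
    exact add_mem hx hy
  | smul r x _ hx =>
    rw [mul_smul_comm, smul_mul_assoc, ← smul_sub]
    exact Submodule.smul_mem _ r hx

/-- If the commutators of `t` with a generating set lie in a two-sided ideal, so do all
commutators with `t`. -/
lemma commutator_mem_of_adjoin_eq_top {s : Set A} (hs : Algebra.adjoin F s = ⊤)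
    {S : Submodule F A} (hS : IsTwoSided S) {t : A} (h : ∀ x ∈ s, t * x - x * t ∈ S) (b : A) :
    t * b - b * t ∈ S := by
  have hb : b ∈ Algebra.adjoin F s := hs ▸ Algebra.mem_top
  induction hb using Algebra.adjoin_induction with
  | mem x hx => exact h x hx
  | algebraMap r => simp [Algebra.commutes]
  | add x y _ _ hx hy =>
    have : t * (x + y) - (x + y) * t = (t * x - x * t) + (t * y - y * t) := by noncomm_ring
    rw [this]
    exact add_mem hx hy
  | mul x y _ _ hx hy =>
    have : t * (x * y) - x * y * t = (t * x - x * t) * y + x * (t * y - y * t) := by noncomm_ring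
    rw [this]
    exact add_mem (hS y _ hx).2 (hS x _ hy).1

end LiePowers

section Generators

variable {F A H : Type*} [Field F] [Ring A] [Algebra F A] [LieRing H] [LieAlgebra F H]
  {f : H →ₗ[F] A}

lemma map_lowerCentralSeries_le_upperLiePower
    (hf : ∀ x y, f ⁅x, y⁆ = f x * f y - f y * f x) (n : ℕ) :
    ∀ x ∈ LieModule.lowerCentralSeries F H H n, f x ∈ upperLiePower F A n := by
  induction n with
  | zero => exact fun _ _ => trivial
  | succ n ih =>
    intro x hx
    rw [LieModule.lowerCentralSeries_succ, ← LieSubmodule.mem_toSubmodule,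
      LieSubmodule.lieIdeal_oper_eq_linear_span'] at hx
    induction hx using Submodule.span_induction with
    | mem z hz =>
      obtain ⟨x, -, y, hy, rfl⟩ := hz
      rw [← lie_skew, map_neg, hf]
      exact neg_mem (commutator_mem_upperLiePower (ih y hy) _)
    | zero => simp
    | add x y _ _ hx hy => rw [map_add]; exact add_mem hx hy
    | smul r x _ hx => rw [map_smul]; exact Submodule.smul_mem _ r hx

/-- In an algebra generated by the image of a Lie algebra `H`, the upper Lie powers are generated,
modulo products of lower ones, by the lower central series of `H`. -/
lemma upperLiePower_le_sup_upperLieProduct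
    (hf : ∀ x y, f ⁅x, y⁆ = f x * f y - f y * f x)
    (hgen : Algebra.adjoin F (Set.range f) = ⊤) {n : ℕ} (hn : 1 ≤ n) :
    upperLiePower F A n ≤
      ⊤ * (LieModule.lowerCentralSeries F H H n).toSubmodule.map f * ⊤
        ⊔ upperLieProduct F A n := by
  have comm_mem : ∀ n, ∀ z ∈ LieModule.lowerCentralSeries F H H n, ∀ b, f z * b - b * f z ∈
      ⊤ * (LieModule.lowerCentralSeries F H H (n + 1)).toSubmodule.map f * ⊤ := by
    intro n z hz
    refine commutator_mem_of_adjoin_eq_top hgen (isTwoSided_top_mul_mul_top _) ?_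
    rintro _ ⟨x, rfl⟩
    rw [← hf, ← lie_skew, map_neg]
    refine neg_mem (le_top_mul_mul_top _ ⟨⁅x, z⁆, ?_, rfl⟩)
    rw [SetLike.mem_coe, LieSubmodule.mem_toSubmodule, LieModule.lowerCentralSeries_succ]
    exact LieSubmodule.lie_mem_lie (LieSubmodule.mem_top x) hz
  induction n, hn using Nat.le_induction with
  | base =>
    refine le_trans ?_ le_sup_left
    refine upperLiePower_succ_le (isTwoSided_top_mul_mul_top _) fun a _ b => ?_
    refine commutator_mem_of_adjoin_eq_top hgen (isTwoSided_top_mul_mul_top _) ?_ b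
    rintro _ ⟨y, rfl⟩
    rw [← neg_sub]
    exact neg_mem (comm_mem 0 y (by simp) a)
  | succ n hn ih =>
    have two_sided := (isTwoSided_top_mul_mul_top
      ((LieModule.lowerCentralSeries F H H (n + 1)).toSubmodule.map f)).sup
      (isTwoSided_upperLieProduct (n + 1))
    refine upperLiePower_succ_le two_sided fun a ha b => ?_
    obtain ⟨x, hx, y, hy, rfl⟩ := Submodule.mem_sup.mp (ih ha)
    have : (x + y) * b - b * (x + y) = (x * b - b * x) + (y * b - b * y) := by noncomm_ring
    rw [this]
    refine add_mem ?_ (Submodule.mem_sup_right (commutator_mem_upperLieProduct hy b))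
    suffices h : ⊤ * (LieModule.lowerCentralSeries F H H n).toSubmodule.map f * ⊤ ≤
        (⊤ * (LieModule.lowerCentralSeries F H H (n + 1)).toSubmodule.map f * ⊤
          ⊔ upperLieProduct F A (n + 1)).comap (LinearMap.mulRight F b - LinearMap.mulLeft F b)
      from h hx
    refine top_mul_mul_top_le_of_forall ?_
    rintro _ ⟨z, hz, rfl⟩ c d
    have hzn := map_lowerCentralSeries_le_upperLiePower hf n z hz
    have expand : c * f z * d * b - b * (c * f z * d) = (c * b - b * c) * (f z * d)
        + c * (f z * b - b * f z) * d + (c * f z) * (d * b - b * d) := by noncomm_ring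
    rw [Submodule.mem_comap, LinearMap.sub_apply, LinearMap.mulRight_apply,
      LinearMap.mulLeft_apply, expand]
    refine add_mem (add_mem (Submodule.mem_sup_right ?_) (Submodule.mem_sup_left ?_))
      (Submodule.mem_sup_right ?_)
    · exact mul_mem_upperLieProduct le_rfl hn (by omega)
        (commutator_mem_upperLiePower (n := 0) trivial b)
        (isTwoSided_upperLiePower n d _ hzn).2
    · exact (isTwoSided_top_mul_mul_top _ d _
        (isTwoSided_top_mul_mul_top _ c _ (comm_mem n z hz b)).1).2
    · exact mul_mem_upperLieProduct hn le_rfl rfl (isTwoSided_upperLiePower n c _ hzn).1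
        (commutator_mem_upperLiePower (n := 0) trivial b)

end Generators

section Representations

variable {F A L M : Type*} [Field F] [Ring A] [Algebra F A] [LieRing L] [LieAlgebra F L]
  [AddCommGroup M] [Module F M] [LieRingModule L M]

/-- The elements of `A` which raise the degree in the lower central series of `M` by `i`. -/
def raising (ρ : A →ₐ[F] Module.End F M) (i : ℕ) : Submodule F A where
  carrier := {a | ∀ k, ∀ v ∈ LieModule.lowerCentralSeries F L M k,
    ρ a v ∈ LieModule.lowerCentralSeries F L M (k + i)}
  zero_mem' k v _ := by simp
  add_mem' ha hb k v hv := by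
    rw [map_add, LinearMap.add_apply]
    exact add_mem (ha k v hv) (hb k v hv)
  smul_mem' r a ha k v hv := by
    rw [map_smul, LinearMap.smul_apply]
    exact SMulMemClass.smul_mem r (ha k v hv)

variable {e : L →ₗ[F] A} {ρ : A →ₐ[F] Module.End F M}

lemma mul_mem_raising {i j : ℕ} {a b : A} (ha : a ∈ raising (L := L) ρ i)
    (hb : b ∈ raising (L := L) ρ j) : a * b ∈ raising (L := L) ρ (i + j) := by
  intro k v hv
  rw [map_mul, Module.End.mul_apply, add_comm i j, ← add_assoc]
  exact ha _ _ (hb k v hv)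

lemma apply_mem_raising (hρ : ∀ x v, ρ (e x) v = ⁅x, v⁆) (x : L) :
    e x ∈ raising (L := L) ρ 1 := by
  intro k v hv
  rw [hρ, LieModule.lowerCentralSeries_succ]
  exact LieSubmodule.lie_mem_lie (LieSubmodule.mem_top x) hv

lemma raising_zero (hρ : ∀ x v, ρ (e x) v = ⁅x, v⁆)
    (hgen : Algebra.adjoin F (Set.range e) = ⊤) : raising (L := L) ρ 0 = ⊤ := by
  rw [eq_top_iff]
  intro a _
  have ha : a ∈ Algebra.adjoin F (Set.range e) := hgen ▸ Algebra.mem_top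
  induction ha using Algebra.adjoin_induction with
  | mem x hx =>
    obtain ⟨x, rfl⟩ := hx
    intro k v hv
    rw [hρ]
    exact LieSubmodule.lie_mem _ hv
  | algebraMap r =>
    intro k v hv
    rw [AlgHom.commutes, Module.algebraMap_end_apply]
    exact SMulMemClass.smul_mem r hv
  | add x y _ _ hx hy => exact add_mem (hx trivial) (hy trivial)
  | mul x y _ _ hx hy => exact mul_mem_raising (hx trivial) (hy trivial)

lemma isTwoSided_raising (hρ : ∀ x v, ρ (e x) v = ⁅x, v⁆)
    (hgen : Algebra.adjoin F (Set.range e) = ⊤) (i : ℕ) : IsTwoSided (raising (L := L) ρ i) := by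
  intro a s hs
  have ha : a ∈ raising (L := L) ρ 0 := raising_zero hρ hgen ▸ Submodule.mem_top
  exact ⟨zero_add i ▸ mul_mem_raising ha hs, add_zero i ▸ mul_mem_raising hs ha⟩

/-- In positive degree, the `i`-th upper Lie power raises the degree by one more than `i`. -/
lemma upperLiePower_le_raising (hρ : ∀ x v, ρ (e x) v = ⁅x, v⁆)
    (hgen : Algebra.adjoin F (Set.range e) = ⊤) {i : ℕ} (hi : 1 ≤ i) :
    upperLiePower F A i ≤ raising (L := L) ρ (i + 1) := by
  have comm_mem {i : ℕ} {a : A} (ha : a ∈ raising (L := L) ρ i) (b : A) :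
      a * b - b * a ∈ raising (L := L) ρ (i + 1) := by
    refine commutator_mem_of_adjoin_eq_top hgen (isTwoSided_raising hρ hgen _) ?_ b
    rintro _ ⟨x, rfl⟩
    have hx := apply_mem_raising hρ x
    exact sub_mem (mul_mem_raising ha hx) (add_comm i 1 ▸ mul_mem_raising hx ha)
  induction i, hi using Nat.le_induction with
  | base =>
    refine upperLiePower_succ_le (isTwoSided_raising hρ hgen _) fun a _ b => ?_
    refine commutator_mem_of_adjoin_eq_top hgen (isTwoSided_raising hρ hgen _) ?_ b
    rintro _ ⟨y, rfl⟩
    rw [← neg_sub]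
    exact neg_mem (comm_mem (apply_mem_raising hρ y) a)
  | succ i hi ih =>
    exact upperLiePower_succ_le (isTwoSided_raising hρ hgen _) fun a ha b => comm_mem (ih ha) b

lemma upperLieProduct_le_raising (hρ : ∀ x v, ρ (e x) v = ⁅x, v⁆)
    (hgen : Algebra.adjoin F (Set.range e) = ⊤) (n : ℕ) :
    upperLieProduct F A n ≤ raising (L := L) ρ (n + 2) := by
  rw [upperLieProduct, Submodule.span_le]
  rintro _ ⟨i, j, hi, hj, rfl, a, ha, b, hb, rfl⟩
  have := mul_mem_raising (upperLiePower_le_raising hρ hgen hi ha)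
    (upperLiePower_le_raising hρ hgen hj hb)
  rwa [show i + 1 + (j + 1) = i + j + 2 by omega] at this

/-- If `A` is generated by the image of `L`, acts on a nilpotent module of `L` compatibly with the
action of `L`, and some vector is annihilated by no nonzero element of `A`, then some upper Lie
power of `A` vanishes. -/
lemma exists_upperLiePower_eq_bot [LieModule F L M] [LieModule.IsNilpotent L M]
    (hρ : ∀ x v, ρ (e x) v = ⁅x, v⁆)
    (hgen : Algebra.adjoin F (Set.range e) = ⊤) {v : M} (hv : ∀ a, ρ a v = 0 → a = 0) :
    ∃ n, upperLiePower F A n = ⊥ := by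
  obtain ⟨k, hk⟩ := LieModule.IsNilpotent.nilpotent F L M
  refine ⟨k + 1, (Submodule.eq_bot_iff _).mpr fun a ha => hv a ?_⟩
  have h := upperLiePower_le_raising hρ hgen (by omega) ha 0 v (by simp)
  have := LieModule.antitone_lowerCentralSeries F L M (show k ≤ 0 + (k + 1 + 1) by omega) h
  simpa [hk] using this

end Representations

section Adjoint

variable {F A L H : Type*} [Field F] [Ring A] [Algebra F A]
  [LieRing L] [LieAlgebra F L] [LieRing H] [LieAlgebra F H]
  {e : L →ₗ[F] A} {f : H →ₗ[F] A} {ρ : A →ₐ[F] Module.End F L}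

lemma lowerCentralSeries_succ_le {n : ℕ} {N : LieSubmodule F L L}
    (h : ∀ x ∈ LieModule.lowerCentralSeries F L L n, ∀ y : L, ⁅x, y⁆ ∈ N) :
    LieModule.lowerCentralSeries F L L (n + 1) ≤ N := by
  rw [LieModule.lowerCentralSeries_succ, LieSubmodule.lieIdeal_oper_eq_span,
    LieSubmodule.lieSpan_le]
  rintro _ ⟨⟨y, -⟩, ⟨x, hx⟩, rfl⟩
  rw [← lie_skew]
  exact neg_mem (h x hx y)

lemma exists_lowerCentralSeries_eq_bot (hρ : ∀ x y, ρ (e x) y = ⁅x, y⁆)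
    (he : ∀ x y, e ⁅x, y⁆ = e x * e y - e y * e x) {n : ℕ} (hn : upperLiePower F A n = ⊥) :
    ∃ k, LieModule.lowerCentralSeries F L L k = ⊥ := by
  refine ⟨n + 1, le_bot_iff.mp (lowerCentralSeries_succ_le fun x hx y => ?_)⟩
  have : e x = 0 := by
    simpa [hn] using map_lowerCentralSeries_le_upperLiePower he n x hx
  rw [← hρ, this]
  simp

lemma lowerCentralSeries_succ_le_add_two (hρ : ∀ x y, ρ (e x) y = ⁅x, y⁆)
    (he : ∀ x y, e ⁅x, y⁆ = e x * e y - e y * e x)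
    (hf : ∀ x y, f ⁅x, y⁆ = f x * f y - f y * f x)
    (hegen : Algebra.adjoin F (Set.range e) = ⊤) (hfgen : Algebra.adjoin F (Set.range f) = ⊤)
    {c : ℕ} (hc : 1 ≤ c) (hH : LieModule.lowerCentralSeries F H H c = ⊥) :
    LieModule.lowerCentralSeries F L L (c + 1) ≤ LieModule.lowerCentralSeries F L L (c + 2) := by
  refine lowerCentralSeries_succ_le fun x hx y => ?_
  have h := upperLiePower_le_sup_upperLieProduct hf hfgen hc
    (map_lowerCentralSeries_le_upperLiePower he c x hx)
  simp only [hH, LieSubmodule.bot_toSubmodule, Submodule.map_bot, Submodule.mul_bot,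
    Submodule.bot_mul, bot_sup_eq] at h
  simpa [hρ] using upperLieProduct_le_raising hρ hegen c h 0 y (by simp)

/-- If `H` and `L` both generate `A`, and the adjoint representation of `L` extends to `A`, then
the class of `L` exceeds that of `H` by at most one. -/
lemma nilClass_le_nilClass_add_one (hρ : ∀ x y, ρ (e x) y = ⁅x, y⁆)
    (he : ∀ x y, e ⁅x, y⁆ = e x * e y - e y * e x)
    (hf : ∀ x y, f ⁅x, y⁆ = f x * f y - f y * f x)
    (hegen : Algebra.adjoin F (Set.range e) = ⊤) (hfgen : Algebra.adjoin F (Set.range f) = ⊤)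
    (hL : ∃ k, LieModule.lowerCentralSeries F L L k = ⊥)
    (hH : ∃ k, LieModule.lowerCentralSeries F H H k = ⊥) :
    nilClass F L ≤ nilClass F H + 1 := by
  have hc : LieModule.lowerCentralSeries F H H (nilClass F H) = ⊥ := Nat.sInf_mem hH
  refine Nat.sInf_le (show LieModule.lowerCentralSeries F L L (nilClass F H + 1) = ⊥ from ?_)
  rcases Nat.eq_zero_or_pos (nilClass F H) with h0 | hpos
  · rw [h0] at hc ⊢
    refine le_bot_iff.mp (lowerCentralSeries_succ_le fun x _ y => ?_)
    have hf0 : ∀ z, f z = 0 := fun z => by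
      have hz : z ∈ LieModule.lowerCentralSeries F H H 0 := by simp
      rw [hc, LieSubmodule.mem_bot] at hz
      rw [hz, map_zero]
    have hx : e x ∈ (⊥ : Subalgebra F A) := by
      have : Algebra.adjoin F (Set.range f) ≤ ⊥ := by
        rw [Algebra.adjoin_le_iff]
        rintro _ ⟨z, rfl⟩
        rw [hf0]
        exact zero_mem _
      exact this (hfgen ▸ Algebra.mem_top)
    obtain ⟨r, hr⟩ := Algebra.mem_bot.mp hx
    have hsmul : ∀ y : L, ⁅x, y⁆ = r • y := fun y => by
      rw [← hρ, ← hr, AlgHom.commutes, Module.algebraMap_end_apply]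
    have h0 : r • x = 0 := by rw [← hsmul, lie_self]
    rcases smul_eq_zero.mp h0 with rfl | rfl
    · simp [hsmul]
    · simp
  · have hle := lowerCentralSeries_succ_le_add_two hρ he hf hegen hfgen hpos hc
    set c := nilClass F H
    have stable : ∀ k, LieModule.lowerCentralSeries F L L (c + 1) ≤
        LieModule.lowerCentralSeries F L L (c + 1 + k) := by
      intro k
      induction k with
      | zero => exact le_rfl
      | succ k ih =>
        refine hle.trans ?_
        rw [LieModule.lowerCentralSeries_succ F L L (c + 1),
          ← add_assoc, LieModule.lowerCentralSeries_succ F L L (c + 1 + k)]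
        exact LieSubmodule.mono_lie_right ⊤ ih
    obtain ⟨k, hk⟩ := hL
    refine le_bot_iff.mp ((stable k).trans ?_)
    rw [← hk]
    exact LieModule.antitone_lowerCentralSeries F L L (by omega)

end Adjoint

section RestrictedEnveloping

variable (p : ℕ) (F : Type*) [Field F] (L : Type*) [LieRing L] [LieAlgebra F L]
  [RestrictedLieAlgebra p F L]

lemma uemb_lie (x y : L) :
    uemb p F L ⁅x, y⁆ = uemb p F L x * uemb p F L y - uemb p F L y * uemb p F L x := by
  change RingQuot.mkAlgHom F (uRel p F L) (ι F ⁅x, y⁆) = _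
  rw [LieHom.map_lie, LieRing.of_associative_ring_bracket, map_sub, map_mul, map_mul]
  rfl

lemma uemb_pmap (x : L) : uemb p F L (pmap p F L x) = uemb p F L x ^ p := by
  change RingQuot.mkAlgHom F (uRel p F L) (ι F (pmap p F L x))
    = RingQuot.mkAlgHom F (uRel p F L) (ι F x) ^ p
  rw [← map_pow]
  exact (RingQuot.mkAlgHom_rel F (⟨x, rfl, rfl⟩ : uRel p F L _ _)).symm

lemma adjoin_range_uemb : Algebra.adjoin F (Set.range (uemb p F L)) = ⊤ := by
  set q := (RingQuot.mkAlgHom F (uRel p F L)).comp (UniversalEnvelopingAlgebra.mkAlgHom F L)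
  have hq : Function.Surjective q :=
    (RingQuot.mkAlgHom_surjective F _).comp (RingCon.mk'_surjective _)
  have hr : Set.range (uemb p F L) = q '' Set.range (TensorAlgebra.ι F (M := L)) := by
    rw [← Set.range_comp]
    rfl
  rw [hr, ← AlgHom.map_adjoin, TensorAlgebra.adjoin_range_ι, Algebra.map_top,
    AlgHom.range_eq_top]
  exact hq

/-- The adjoint representation of a restricted Lie algebra, extended to its restricted enveloping
algebra. -/
noncomputable def uAd : uEnv p F L →ₐ[F] Module.End F L :=
  RingQuot.liftAlgHom F
    ⟨UniversalEnvelopingAlgebra.lift F (LieAlgebra.ad F L), by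
      rintro a b ⟨x, rfl, rfl⟩
      ext y
      rw [map_pow, UniversalEnvelopingAlgebra.lift_ι_apply,
        UniversalEnvelopingAlgebra.lift_ι_apply, LieAlgebra.ad_apply]
      exact (ad_pOp x y).symm⟩

lemma uAd_uemb (x y : L) : uAd p F L (uemb p F L x) y = ⁅x, y⁆ := by
  change uAd p F L (RingQuot.mkAlgHom F (uRel p F L) (ι F x)) y = _
  rw [uAd, RingQuot.liftAlgHom_mkAlgHom_apply, UniversalEnvelopingAlgebra.lift_ι_apply,
    LieAlgebra.ad_apply]

lemma isNilpotent_uemb (hL : IsPNilpotent p F L) (x : L) : IsNilpotent (uemb p F L x) := by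
  obtain ⟨s, hs⟩ := hL
  have hmem : ∀ n, (pmap p F L)^[n] x ∈ (subPPow p F)^[n] (⊤ : LieSubalgebra F L) := by
    intro n
    induction n with
    | zero => simp
    | succ n ih =>
      rw [Function.iterate_succ_apply', Function.iterate_succ_apply', subPPow, restrictedClosure,
        ← SetLike.mem_coe, LieSubalgebra.coe_sInf]
      exact Set.mem_iInter₂.mpr fun K hK => hK.1 ⟨_, ih, rfl⟩
  have hpow : ∀ n, uemb p F L ((pmap p F L)^[n] x) = uemb p F L x ^ p ^ n := by
    intro n
    induction n with
    | zero => simp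
    | succ n ih => rw [Function.iterate_succ_apply', uemb_pmap, ih, ← pow_mul, ← pow_succ]
  have h0 := hmem s
  rw [hs, LieSubalgebra.mem_bot] at h0
  exact ⟨p ^ s, by rw [← hpow, h0, map_zero]⟩

lemma finite_uEnv [Fact p.Prime] [FiniteDimensional F L] : Module.Finite F (uEnv p F L) := by
  set b := Module.finBasis F L
  set e : Option (Fin (Module.finrank F L)) → uEnv p F L := fun i => i.elim 1 (uemb p F L ∘ b)
  have h1 : 1 ∈ Submodule.span F (Set.range e) := Submodule.subset_span ⟨none, rfl⟩
  have hL : ∀ x, uemb p F L x ∈ Submodule.span F (Set.range e) := by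
    intro x
    have hx : x ∈ Submodule.span F (Set.range b) := b.span_eq ▸ Submodule.mem_top
    have := Submodule.mem_map_of_mem (f := uemb p F L) hx
    rw [Submodule.map_span] at this
    refine Submodule.span_mono ?_ this
    rintro _ ⟨_, ⟨i, rfl⟩, rfl⟩
    exact ⟨some i, rfl⟩
  refine finite_of_commutator_mem_of_pow_mem (e := e) (p := p) (Fact.out : p.Prime).two_le h1
    ?_ ?_ ?_
  · rintro (_ | i) (_ | j)
    · simp [e]
    · simp [e]
    · simp [e]
    · change uemb p F L (b i) * uemb p F L (b j) - uemb p F L (b j) * uemb p F L (b i) ∈ _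
      rw [← uemb_lie]
      exact hL _
  · rintro (_ | i)
    · simpa [e] using h1
    · change uemb p F L (b i) ^ p ∈ _
      rw [← uemb_pmap]
      exact hL _
  · rw [eq_top_iff, ← adjoin_range_uemb, Algebra.adjoin_le_iff]
    rintro _ ⟨x, rfl⟩
    exact Algebra.span_le_adjoin F _ (hL x)

lemma exists_upperLiePower_uEnv_eq_bot [Fact p.Prime] [FiniteDimensional F L]
    (hL : IsPNilpotent p F L) : ∃ n, upperLiePower F (uEnv p F L) n = ⊥ := by
  have := finite_uEnv p F L
  let _ : LieRingModule L (uEnv p F L) :=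
    { bracket := fun x a => uemb p F L x * a
      add_lie := fun x y a => by
        change uemb p F L (x + y) * a = _
        rw [map_add, add_mul]
      lie_add := fun x a b => mul_add _ a b
      leibniz_lie := fun x y a => by
        change uemb p F L x * (uemb p F L y * a)
          = uemb p F L ⁅x, y⁆ * a + uemb p F L y * (uemb p F L x * a)
        rw [uemb_lie]
        noncomm_ring }
  have : LieModule F L (uEnv p F L) :=
    { smul_lie := fun r x a => by
        change uemb p F L (r • x) * a = r • (uemb p F L x * a)
        rw [map_smul, smul_mul_assoc]
      lie_smul := fun r x a => mul_smul_comm r (uemb p F L x) a }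
  have : LieModule.IsNilpotent L (uEnv p F L) := by
    rw [LieModule.isNilpotent_iff_forall (R := F)]
    intro x
    exact (isNilpotent_uemb p F L hL x).map (Algebra.lmul F (uEnv p F L))
  exact exists_upperLiePower_eq_bot (ρ := Algebra.lmul F (uEnv p F L)) (e := uemb p F L)
    (fun _ _ => rfl) (adjoin_range_uemb p F L) (v := 1)
    fun a ha => by simpa using ha

end RestrictedEnveloping

end RestrictedLieAlgebra

open RestrictedLieAlgebra in
/-- If `u(L) ≅ u(H)` and `L` is finite-dimensional and `p`-nilpotent, then the
nilpotence classes of `L` and `H` differ by at most one. -/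
theorem nilpotence_class_almost_determined
    (p : ℕ) (F L H : Type*) [Field F] [Fact p.Prime] [CharP F p]
    [LieRing L] [LieAlgebra F L] [RestrictedLieAlgebra p F L]
    [LieRing H] [LieAlgebra F H] [RestrictedLieAlgebra p F H]
    [FiniteDimensional F L] (hL : IsPNilpotent p F L)
    (hiso : Nonempty (uEnv p F L ≃ₐ[F] uEnv p F H)) :
    nilClass F L ≤ nilClass F H + 1 ∧ nilClass F H ≤ nilClass F L + 1 := by
  obtain ⟨φ⟩ := hiso
  have hcomp (x y : H) : (φ.symm.toLinearMap ∘ₗ uemb p F H) ⁅x, y⁆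
      = (φ.symm.toLinearMap ∘ₗ uemb p F H) x * (φ.symm.toLinearMap ∘ₗ uemb p F H) y
        - (φ.symm.toLinearMap ∘ₗ uemb p F H) y * (φ.symm.toLinearMap ∘ₗ uemb p F H) x := by
    simp [uemb_lie]
  have hgen : Algebra.adjoin F (Set.range (φ.symm.toLinearMap ∘ₗ uemb p F H)) = ⊤ := by
    have hr : Set.range (φ.symm.toLinearMap ∘ₗ uemb p F H)
        = (φ.symm : uEnv p F H →ₐ[F] uEnv p F L) '' Set.range (uemb p F H) := by
      rw [← Set.range_comp]
      rfl
    rw [hr, ← AlgHom.map_adjoin, adjoin_range_uemb, Algebra.map_top, AlgHom.range_eq_top]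
    exact φ.symm.surjective
  have hρ (x y : H) : ((uAd p F H).comp φ.toAlgHom)
      ((φ.symm.toLinearMap ∘ₗ uemb p F H) x) y = ⁅x, y⁆ := by
    simp [uAd_uemb]
  obtain ⟨n, hn⟩ := exists_upperLiePower_uEnv_eq_bot p F L hL
  have hLnil := exists_lowerCentralSeries_eq_bot (uAd_uemb p F L) (uemb_lie p F L) hn
  have hHnil := exists_lowerCentralSeries_eq_bot hρ hcomp hn
  exact ⟨nilClass_le_nilClass_add_one (uAd_uemb p F L) (uemb_lie p F L) hcomp
      (adjoin_range_uemb p F L) hgen hLnil hHnil,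
    nilClass_le_nilClass_add_one hρ hcomp (uemb_lie p F L) hgen
      (adjoin_range_uemb p F L) hHnil hLnil⟩
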